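/- Let F(F∞) be the category with objects the natural numbers and with Hom(n, m) the set of injective functions F(n) → F(m) preserving ∔, − and 0 (injections of free F∞-modules), with composition of functions. Then F(F∞) is locally Noetherian: for every left-Noetherian ring k and every finitely generated functor F : F(F∞) ⥤ ModuleCat k, every subfunctor of F is finitely generated. -/

import Mathlib

open CategoryTheory
open scoped Classical

/-- Nonzero vectors of the free F∞-module of rank `m`. -/
abbrev FVec (m : ℕ) : Type := {σ : Fin m → Option Bool // σ ≠ fun _ => none}

/-- The free F∞-module of rank `m`, with zero `none`. -/
abbrev Fm (m : ℕ) : Type := Option (FVec m)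

/-- Negation on the free F∞-module: Boolean negation on each defined value. -/
def Fm.neg {m : ℕ} : Fm m → Fm m :=
  Option.map (fun σ => ⟨fun i => (σ.val i).map (fun b => !b), by
    intro hcontra
    apply σ.prop
    funext i
    have h := congrFun hcontra i
    simpa using h⟩)

/-- Addition on the free F∞-module: `none` absorbs; two nonzero vectors add to `none`
if they clash in some coordinate, and otherwise to their pointwise merge. -/
noncomputable def Fm.add {m : ℕ} : Fm m → Fm m → Fm m
  | some σ, some τ =>
      if ∃ (i : Fin m) (b : Bool), σ.val i = some b ∧ τ.val i = some (!b) then none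
      else some ⟨fun i => (σ.val i).or (τ.val i), by
        intro hcontra
        apply σ.prop
        funext i
        have h := congrFun hcontra i
        cases hv : σ.val i with
        | none => rfl
        | some b => rw [hv] at h; simp [Option.or] at h⟩
  | _, _ => none

/-- A type with F∞-module operations `0`, `∔`, `−`. -/
class FStr (α : Type) where
  z : α
  add : α → α → α
  neg : α → α

noncomputable instance {m : ℕ} : FStr (Fm m) :=
  ⟨none, Fm.add, Fm.neg⟩

/-- A map preserving `0`, `∔` and `−`. -/
def IsFHom {α β : Type} [FStr α] [FStr β] (f : α → β) : Prop :=
  f FStr.z = FStr.z ∧ (∀ x y, f (FStr.add x y) = FStr.add (f x) (f y)) ∧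
    ∀ x, f (FStr.neg x) = FStr.neg (f x)
/-- A functor `F : C ⥤ ModuleCat k` is finitely generated if finitely many elements
`α_j ∈ F(Z_j)` exist such that every `F(W)` is the `k`-span of their images. -/
def FunctorFG {C : Type*} [Category C] {k : Type} [Ring k]
    (F : C ⥤ ModuleCat.{0} k) : Prop :=
  ∃ (ℓ : ℕ) (Z : Fin ℓ → C) (α : ∀ j, F.obj (Z j)),
    ∀ W : C, (⊤ : Submodule k (F.obj W)) =
      Submodule.span k {v | ∃ (j : Fin ℓ) (h : Z j ⟶ W), v = F.map h (α j)}

/-- A subfunctor of `F`: a choice of submodules closed under all the maps `F(h)`. -/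
def IsSubfunctor {C : Type*} [Category C] {k : Type} [Ring k]
    (F : C ⥤ ModuleCat.{0} k) (M : ∀ Z : C, Submodule k (F.obj Z)) : Prop :=
  ∀ ⦃Z W : C⦄ (h : Z ⟶ W) (x : F.obj Z), x ∈ M Z → F.map h x ∈ M W

/-- A subfunctor `M` of `F` is finitely generated if finitely many elements
`α_j ∈ M(Z_j)` exist such that every `M(W)` is the `k`-span of their images. -/
def SubfunctorFG {C : Type*} [Category C] {k : Type} [Ring k]
    (F : C ⥤ ModuleCat.{0} k) (M : ∀ Z : C, Submodule k (F.obj Z)) : Prop :=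
  ∃ (ℓ : ℕ) (Z : Fin ℓ → C) (α : ∀ j, F.obj (Z j)),
    (∀ j, α j ∈ M (Z j)) ∧
    ∀ W : C, M W = Submodule.span k {v | ∃ (j : Fin ℓ) (h : Z j ⟶ W), v = F.map h (α j)}

/-- A category is locally Noetherian if for every left-Noetherian ring `k`, every
subfunctor of every finitely generated functor `C ⥤ ModuleCat k` is finitely
generated. -/
def LocallyNoetherian (C : Type*) [Category C] : Prop :=
  ∀ (k : Type) [Ring k] [IsNoetherianRing k] (F : C ⥤ ModuleCat.{0} k),
    FunctorFG F → ∀ M : ∀ Z : C, Submodule k (F.obj Z), IsSubfunctor F M → SubfunctorFG F M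

/-- Objects of the category `F(F∞)`: natural numbers, indexing the free F∞-modules
`F(n)`. -/
structure FF : Type where
  n : ℕ

/-- The category `F(F∞)`: morphisms `a ⟶ b` are the injective maps `F(a) → F(b)`
preserving `∔`, `−` and `0` (injections of free F∞-modules). -/
noncomputable instance : Category.{0} FF where
  Hom a b := {f : Fm a.n → Fm b.n // IsFHom f ∧ Function.Injective f}
  id a := ⟨id, ⟨rfl, fun _ _ => rfl, fun _ => rfl⟩, fun _ _ h => h⟩
  comp f g := ⟨g.1 ∘ f.1,
    ⟨by simp [Function.comp, f.2.1.1, g.2.1.1],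
     fun x y => by simp [Function.comp, f.2.1.2.1, g.2.1.2.1],
     fun x => by simp [Function.comp, f.2.1.2.2, g.2.1.2.2]⟩,
    fun _ _ h => f.2.2 (g.2.2 h)⟩
  id_comp f := rfl
  comp_id f := rfl
  assoc f g h := rfl

/-- A well quasi-order on `Q` has finite bases, even compatibly with a monotone map to a
well-founded poset. -/
theorem finite_basis {Q L : Type} [PartialOrder L] [WellFoundedGT L] (r : Q → Q → Prop)
    [IsPreorder Q r] (hw : WellQuasiOrdered r) (I : Q → L) (hI : ∀ p q, r p q → I p ≤ I q) :
    ∃ T : Finset Q, ∀ q, ∃ p ∈ T, r p q ∧ I p = I q := by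
  by_contra hcon
  push Not at hcon
  obtain ⟨f, -, hf⟩ := exists_seq_of_forall_finset_exists (fun _ : Q => True)
    (fun p q => r p q → I p ≠ I q) (fun s _ => by
      obtain ⟨q, hq⟩ := hcon s
      exact ⟨q, trivial, hq⟩)
  obtain ⟨g, hg⟩ := hw.exists_monotone_subseq f
  obtain ⟨n, hn⟩ := WellFoundedGT.monotone_chain_condition
    (⟨fun n => I (f (g n)), fun a b hab => hI _ _ (hg a b hab)⟩ : ℕ →o L)
  exact hf (g n) (g (n + 1)) (g.strictMono (Nat.lt_succ_self n)) (hg _ _ (Nat.le_succ n))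
    (hn (n + 1) (Nat.le_succ n))

/-- Abstract Gröbner argument. -/
theorem groebner {C : Type} [Category.{0} C] {k : Type} [Ring k] [IsNoetherianRing k]
    (F : C ⥤ ModuleCat.{0} k) (X : C → Type) [∀ W, Finite (X W)] [∀ W, LinearOrder (X W)]
    (e : ∀ W, X W → F.obj W)
    (hspan : ∀ W, (⊤ : Submodule k (F.obj W)) = Submodule.span k (Set.range (e W)))
    (r : (Σ W, X W) → (Σ W, X W) → Prop) [IsPreorder _ r] (hw : WellQuasiOrdered r)
    (hr : ∀ p q, r p q → ∃ h : p.1 ⟶ q.1, F.map h (e p.1 p.2) = e q.1 q.2 ∧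
      ∀ y, y < p.2 → ∃ y', y' < q.2 ∧ F.map h (e p.1 y) = e q.1 y')
    (M : ∀ Z : C, Submodule k (F.obj Z)) (hM : IsSubfunctor F M) : SubfunctorFG F M := by
  have hfin : ∀ W, Module.Finite k (F.obj W) := fun W =>
    ⟨by rw [hspan W]; exact Submodule.fg_span (Set.finite_range _)⟩
  have hfg : ∀ W, (M W).FG := fun W => IsNoetherian.noetherian (M W)
  choose G hG using hfg
  let I : (Σ W, X W) → Submodule k k := fun p =>
    (M p.1 ⊔ Submodule.span k (e p.1 '' {y | y < p.2})).comap
      (LinearMap.toSpanSingleton k (F.obj p.1) (e p.1 p.2))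
  have hpush : ∀ p q : (Σ W, X W), ∀ h : p.1 ⟶ q.1,
      (∀ y, y < p.2 → ∃ y', y' < q.2 ∧ F.map h (e p.1 y) = e q.1 y') →
      ∀ v ∈ Submodule.span k (e p.1 '' {y | y < p.2}),
        F.map h v ∈ Submodule.span k (e q.1 '' {y | y < q.2}) := by
    intro p q h hh v hv
    have : Submodule.span k (e p.1 '' {y | y < p.2}) ≤
        (Submodule.span k (e q.1 '' {y | y < q.2})).comap (F.map h).hom := by
      rw [Submodule.span_le]
      rintro _ ⟨y, hy, rfl⟩
      obtain ⟨y', hy', he⟩ := hh y hy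
      rw [SetLike.mem_coe, Submodule.mem_comap]
      refine (congrArg (· ∈ Submodule.span k (e q.1 '' {y | y < q.2})) he).mpr ?_
      exact Submodule.subset_span ⟨y', hy', rfl⟩
    exact this hv
  have hI : ∀ p q, r p q → I p ≤ I q := by
    intro p q hpq c hc
    obtain ⟨h, h1, h2⟩ := hr p q hpq
    simp only [I, Submodule.mem_comap, LinearMap.toSpanSingleton_apply] at hc ⊢
    obtain ⟨a, ha, b, hb, hab⟩ := Submodule.mem_sup.1 hc
    refine Submodule.mem_sup.2 ⟨F.map h a, hM h a ha, F.map h b, hpush p q h h2 b hb, ?_⟩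
    rw [← map_add, hab, map_smul, h1]
  obtain ⟨T, hT⟩ := finite_basis r hw I hI
  let ι := Σ t : T, (G t.1.1 : Finset (F.obj t.1.1))
  let eq := Fintype.equivFin ι
  let Zf : ι → C := fun i => i.1.1.1
  let αf : ∀ i : ι, F.obj (Zf i) := fun i => i.2.1
  have hα : ∀ i, αf i ∈ M (Zf i) := fun i => by
    rw [← hG]; exact Submodule.subset_span i.2.2
  refine ⟨Fintype.card ι, fun j => Zf (eq.symm j), fun j => αf (eq.symm j),
    fun j => hα _, fun W => le_antisymm ?_ ?_⟩
  swap
  · rw [Submodule.span_le]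
    rintro _ ⟨j, h, rfl⟩
    exact hM h _ (hα _)
  set S := Submodule.span k {v | ∃ (j : Fin (Fintype.card ι)) (h : Zf (eq.symm j) ⟶ W),
    v = F.map h (αf (eq.symm j))} with hS
  have hgen : ∀ t ∈ T, ∀ h : t.1 ⟶ W, ∀ m ∈ M t.1, F.map h m ∈ S := by
    intro t ht h m hm
    have : M t.1 ≤ S.comap (F.map h).hom := by
      rw [← hG, Submodule.span_le]
      intro v hv
      refine Submodule.subset_span ?_
      let i : ι := ⟨⟨t, ht⟩, ⟨v, hv⟩⟩
      have key : ∀ i' : ι, i' = i → ∃ (h' : Zf i' ⟶ W), F.map h v = F.map h' (αf i') := by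
        rintro _ rfl
        exact ⟨h, rfl⟩
      exact ⟨eq i, key _ (eq.symm_apply_apply i)⟩
    exact this hm
  have hmain : ∀ x : X W, ∀ m ∈ M W, m ∈ Submodule.span k (e W '' {y | y ≤ x}) → m ∈ S := by
    intro x
    have hwf : WellFounded ((· < ·) : X W → X W → Prop) := Finite.wellFounded_of_trans_of_irrefl _
    induction x using hwf.induction with
    | _ x ih =>
    -- elements supported strictly below `x`
    have hlt : ∀ m ∈ M W, m ∈ Submodule.span k (e W '' {y | y < x}) → m ∈ S := by
      intro m hm hmx
      by_cases hne : ({y | y < x} : Set (X W)).Nonempty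
      · obtain ⟨z, hz, hmax⟩ := Set.exists_max_image {y | y < x} id (Set.toFinite _) hne
        refine ih z hz m hm (Submodule.span_mono ?_ hmx)
        exact Set.image_mono fun y hy => hmax y hy
      · rw [Set.not_nonempty_iff_eq_empty.1 hne] at hmx
        simp at hmx
        rw [hmx]; exact zero_mem _
    intro m hm hmx
    have hset : e W '' {y | y ≤ x} = insert (e W x) (e W '' {y | y < x}) := by
      rw [← Set.image_insert_eq]; congr 1; ext y; simp [le_iff_eq_or_lt]
    rw [hset, Submodule.mem_span_insert] at hmx
    obtain ⟨c, b, hb, rfl⟩ := hmx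
    obtain ⟨t, ht, htr, hIt⟩ := hT ⟨W, x⟩
    obtain ⟨h, h1, h2⟩ := hr _ _ htr
    have hc : c ∈ I ⟨W, x⟩ := by
      simp only [I, Submodule.mem_comap, LinearMap.toSpanSingleton_apply]
      refine Submodule.mem_sup.2 ⟨_, hm, -b, neg_mem hb, by abel⟩
    rw [← hIt] at hc
    simp only [I, Submodule.mem_comap, LinearMap.toSpanSingleton_apply] at hc
    obtain ⟨m0, hm0, b0, hb0, hab⟩ := Submodule.mem_sup.1 hc
    have hb1 := hpush t ⟨W, x⟩ h h2 b0 hb0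
    have hceq : c • e W x = F.map h m0 + F.map h b0 := by
      rw [← map_add, hab, map_smul, h1]
    have hrest : c • e W x + b - F.map h m0 ∈ S := by
      apply hlt _ (sub_mem hm (hM h m0 hm0))
      have : c • e W x + b - F.map h m0 = F.map h b0 + b := by rw [hceq]; abel
      rw [this]
      exact add_mem hb1 hb
    have := add_mem hrest (hgen t ht h m0 hm0)
    simpa using this
  intro m hm
  have hmt : m ∈ Submodule.span k (Set.range (e W)) := by rw [← hspan]; trivial
  rcases isEmpty_or_nonempty (X W) with hemp | hne
  · rw [Set.range_eq_empty] at hmt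
    simp at hmt
    rw [hmt]; exact zero_mem _
  · obtain ⟨z, hz⟩ := Finite.exists_max (id : X W → X W)
    refine hmain z m hm (Submodule.span_mono ?_ hmt)
    rintro _ ⟨y, rfl⟩
    exact ⟨y, hz y, rfl⟩

/-! ### Words -/

/-- A word, with each letter marked by whether it is a first occurrence. -/
noncomputable def decor {B : Type} {m : ℕ} (w : Fin m → B) : List (B × Bool) :=
  List.ofFn fun p => (w p, decide (∀ q < p, w q ≠ w p))

theorem sublist_wqo (A : Type) [Finite A] :
    WellQuasiOrdered (fun l l' : List A => l.Sublist l') := by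
  have h := Set.PartiallyWellOrderedOn.partiallyWellOrderedOn_sublistForall₂ (α := A)
    (· = ·) (s := Set.univ) (Set.finite_univ.partiallyWellOrderedOn)
  intro f
  obtain ⟨a, b, hab, hs⟩ := h.exists_lt (f := f) (fun n x _ => Set.mem_univ x)
  refine ⟨a, b, hab, ?_⟩
  obtain ⟨l, hl, hl'⟩ := List.sublistForall₂_iff.1 hs
  rw [List.forall₂_eq_eq_eq] at hl
  subst hl
  exact hl'

theorem decor_sublist {B : Type} {m m' : ℕ} (w : Fin m → B) (w' : Fin m' → B)
    (hrange : Set.range w = Set.range w') (hs : (decor w).Sublist (decor w')) :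
    ∃ (g : Fin m' → Fin m) (φ : Fin m → Fin m'), (∀ i, g (φ i) = i) ∧ (∀ q, w (g q) = w' q) ∧
      ∀ i q, q < φ i → g q < i := by
  rw [List.sublist_iff_exists_fin_orderEmbedding_get_eq] at hs
  obtain ⟨f, hf⟩ := hs
  have hl : (decor w).length = m := by simp [decor]
  have hl' : (decor w').length = m' := by simp [decor]
  let φ : Fin m → Fin m' := fun i => (f (i.cast hl.symm)).cast hl'
  have hφ : StrictMono φ := by
    intro a b hab
    have : f (a.cast hl.symm) < f (b.cast hl.symm) := f.strictMono hab
    exact this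
  have hd : ∀ i, (w i, decide (∀ q < i, w q ≠ w i)) =
      (w' (φ i), decide (∀ q < φ i, w' q ≠ w' (φ i))) := by
    intro i
    have := hf (i.cast hl.symm)
    unfold decor at this
    rw [List.get_ofFn, List.get_ofFn] at this
    exact this
  have hd1 : ∀ i, w i = w' (φ i) := fun i => congrArg Prod.fst (hd i)
  have hd2 : ∀ i, (∀ q < i, w q ≠ w i) ↔ (∀ q < φ i, w' q ≠ w' (φ i)) := fun i => by
    have := congrArg Prod.snd (hd i)
    simpa only [decide_eq_decide] using this
  have hfirst : ∀ q : Fin m', ∃ p, w p = w' q ∧ ∀ p' < p, w p' ≠ w p := by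
    intro q
    have hq : w' q ∈ Set.range w := hrange ▸ ⟨q, rfl⟩
    obtain ⟨p, hp⟩ := hq
    obtain ⟨p0, hp0, hmin⟩ := Set.exists_min_image {p | w p = w' q} id (Set.toFinite _) ⟨p, hp⟩
    refine ⟨p0, hp0, fun p' hp' he => ?_⟩
    exact absurd (hmin p' (he.trans hp0)) (not_le.2 hp')
  have hex : ∀ q : Fin m', ∃ p, w p = w' q ∧ (∀ i, φ i = q → p = i) ∧ φ p ≤ q := by
    intro q
    by_cases hq : ∃ i, φ i = q
    · obtain ⟨i, rfl⟩ := hq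
      exact ⟨i, hd1 i, fun j hj => (hφ.injective hj).symm, le_rfl⟩
    · obtain ⟨p, hp, hp'⟩ := hfirst q
      refine ⟨p, hp, fun i hi => absurd ⟨i, hi⟩ hq, ?_⟩
      by_contra hlt
      exact (hd2 p).1 hp' q (not_le.1 hlt) (by rw [← hd1, hp])
  choose g hg1 hg2 hg3 using hex
  exact ⟨g, φ, fun i => hg2 _ i rfl, hg1, fun i q hq => hφ.lt_iff_lt.1 ((hg3 q).trans_lt hq)⟩

/-! ### The category -/

/-- Coordinate `p` of an element of `F(m)`. -/
def coord {m : ℕ} (p : Fin m) : Fm m → Option Bool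
  | none => none
  | some σ => σ.1 p

theorem hom_none {a b : FF} (f : a ⟶ b) : f.1 none = none := f.2.1.1

theorem hom_ext_coord {a b : FF} (f g : a ⟶ b)
    (h : ∀ p x, coord p (f.1 x) = coord p (g.1 x)) : f = g := by
  apply Subtype.ext
  funext x
  cases x with
  | none => rw [hom_none, hom_none]
  | some x =>
    have hf : f.1 (some x) ≠ none := fun h => by
      have := f.2.2 (h.trans (hom_none f).symm)
      cases this
    have hg : g.1 (some x) ≠ none := fun h => by
      have := g.2.2 (h.trans (hom_none g).symm)
      cases this
    obtain ⟨σ, hσ⟩ := Option.ne_none_iff_exists'.1 hf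
    obtain ⟨τ, hτ⟩ := Option.ne_none_iff_exists'.1 hg
    rw [hσ, hτ]
    congr 1
    apply Subtype.ext
    funext p
    have := h p (some x)
    rw [hσ, hτ] at this
    exact this

/-- Pullback of vectors along a surjection. -/
def pullVec {m m' : ℕ} (g : Fin m' → Fin m) (hg : Function.Surjective g) : Fm m → Fm m' :=
  Option.map fun σ => ⟨fun q => σ.1 (g q), fun h => σ.2 (by
    funext i
    obtain ⟨q, rfl⟩ := hg i
    exact congrFun h q)⟩

theorem coord_pullVec {m m' : ℕ} (g : Fin m' → Fin m) (hg : Function.Surjective g) (q : Fin m')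
    (x : Fm m) : coord q (pullVec g hg x) = coord (g q) x := by
  cases x <;> rfl

theorem pullVec_add {m m' : ℕ} (g : Fin m' → Fin m) (hg : Function.Surjective g)
    (x y : Fm m) : pullVec g hg (Fm.add x y) = Fm.add (pullVec g hg x) (pullVec g hg y) := by
  cases x with
  | none => rfl
  | some σ =>
    cases y with
    | none => rfl
    | some τ =>
      have hiff : (∃ (i : Fin m') (b : Bool), σ.val (g i) = some b ∧ τ.val (g i) = some (!b)) ↔
          ∃ (i : Fin m) (b : Bool), σ.val i = some b ∧ τ.val i = some (!b) := by
        constructor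
        · rintro ⟨i, h⟩
          exact ⟨g i, h⟩
        · rintro ⟨i, h⟩
          obtain ⟨q, rfl⟩ := hg i
          exact ⟨q, h⟩
      by_cases h : ∃ (i : Fin m) (b : Bool), σ.val i = some b ∧ τ.val i = some (!b)
      · have h' := hiff.2 h
        simp only [pullVec, Option.map_some, Fm.add]
        rw [if_pos h, if_pos h']
        rfl
      · have h' := fun h' => h (hiff.1 h')
        simp only [pullVec, Option.map_some, Fm.add]
        rw [if_neg h, if_neg h']
        rfl

/-- The morphism of `F(F∞)` given by a surjection. -/
def pull {a b : FF} (g : Fin b.n → Fin a.n) (hg : Function.Surjective g) : a ⟶ b :=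
  ⟨pullVec g hg, ⟨rfl, pullVec_add g hg, fun x => by cases x <;> rfl⟩, by
    intro x y h
    cases x with
    | none =>
      cases y with
      | none => rfl
      | some y => cases h
    | some x =>
      cases y with
      | none => cases h
      | some y =>
        have h' : ∀ p, coord p (some x) = coord p (some y) := by
          intro p
          obtain ⟨q, rfl⟩ := hg p
          rw [← coord_pullVec g hg, ← coord_pullVec g hg, h]
        congr 1
        apply Subtype.ext
        funext p
        exact h' p⟩

/-- Letters. -/
abbrev Letter {l : ℕ} (Z : Fin l → FF) : Type := Σ j, (Fm (Z j).n → Option Bool)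

/-- The word of a morphism: its columns. -/
def wordOf {l : ℕ} (Z : Fin l → FF) {W : FF} (x : Σ j, (Z j ⟶ W)) : Fin W.n → Letter Z :=
  fun p => ⟨x.1, fun v => coord p (x.2.1 v)⟩

theorem wordOf_inj {l : ℕ} (Z : Fin l → FF) {W : FF} (x y : Σ j, (Z j ⟶ W)) (h1 : x.1 = y.1)
    (h : wordOf Z x = wordOf Z y) : x = y := by
  obtain ⟨j, f⟩ := x
  obtain ⟨j', f'⟩ := y
  obtain rfl : j = j' := h1
  congr 1
  apply hom_ext_coord
  intro p v
  have := congrFun h p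
  simp only [wordOf, Sigma.mk.injEq, heq_eq_eq, true_and] at this
  exact congrFun this v

/-- Postcomposition. -/
noncomputable def push {l : ℕ} (Z : Fin l → FF) {W W' : FF} (h : W ⟶ W') (x : Σ j, (Z j ⟶ W)) :
    Σ j, (Z j ⟶ W') := ⟨x.1, x.2 ≫ h⟩

theorem wordOf_push {l : ℕ} (Z : Fin l → FF) {W W' : FF} (g : Fin W'.n → Fin W.n)
    (hg : Function.Surjective g) (x : Σ j, (Z j ⟶ W)) (q : Fin W'.n) :
    wordOf Z (push Z (pull g hg) x) q = wordOf Z x (g q) := by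
  simp only [wordOf, push]
  congr 1
  funext v
  exact coord_pullVec g hg q _

instance homFinite (a b : FF) : Finite (a ⟶ b) :=
  inferInstanceAs (Finite {f : Fm a.n → Fm b.n // IsFHom f ∧ Function.Injective f})

/-- The category `F(F∞)` of free F∞-modules with injections is locally Noetherian:
for every left-Noetherian ring `k`, every subfunctor of every finitely generated
functor `F(F∞) ⥤ ModuleCat k` is finitely generated. -/
theorem stmt18 : LocallyNoetherian FF := by
  intro k _ _ F ⟨l, Z, α, hα⟩ M hM
  obtain ⟨enc, henc⟩ := Countable.exists_injective_nat (Letter Z)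
  let X : FF → Type := fun W => Σ j, (Z j ⟶ W)
  let key : ∀ W, X W → (Fin l ×ₗ Lex (Fin W.n → ℕ)) := fun W x =>
    toLex (x.1, toLex fun p => enc (wordOf Z x p))
  have hkey : ∀ W, Function.Injective (key W) := by
    intro W x y h
    have h' := toLex.injective h
    rw [Prod.mk.injEq] at h'
    apply wordOf_inj Z x y h'.1
    funext p
    exact henc (congrFun (toLex.injective h'.2) p)
  let _ : ∀ W, LinearOrder (X W) := fun W => LinearOrder.lift' (key W) (hkey W)
  let inv : (Σ W, X W) → (Fin l × Set (Letter Z)) × List (Letter Z × Bool) := fun p =>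
    ((p.2.1, Set.range (wordOf Z p.2)), decor (wordOf Z p.2))
  let r : (Σ W, X W) → (Σ W, X W) → Prop := fun p q =>
    (inv p).1 = (inv q).1 ∧ (inv p).2.Sublist (inv q).2
  have : IsPreorder _ r :=
    { refl := fun p => ⟨rfl, List.Sublist.refl _⟩
      trans := fun p q s h1 h2 => ⟨h1.1.trans h2.1, h1.2.trans h2.2⟩ }
  have hw : WellQuasiOrdered r := by
    have h := WellQuasiOrdered.prod
      (Finite.wellQuasiOrdered (· = · : (Fin l × Set (Letter Z)) → _ → Prop))
      (sublist_wqo (Letter Z × Bool))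
    intro f
    exact h (inv ∘ f)
  refine groebner F X (fun W x => F.map x.2 (α x.1)) ?_ r hw ?_ M hM
  · intro W
    rw [hα W]
    congr 1
    ext v
    constructor
    · rintro ⟨j, h, rfl⟩
      exact ⟨⟨j, h⟩, rfl⟩
    · rintro ⟨⟨j, h⟩, rfl⟩
      exact ⟨j, h, rfl⟩
  · rintro ⟨W, x⟩ ⟨W', x'⟩ ⟨h1, h2⟩
    simp only [inv, Prod.mk.injEq] at h1
    obtain ⟨g, φ, hgφ, hgw, hlt⟩ := decor_sublist _ _ h1.2 h2
    have hg : Function.Surjective g := fun i => ⟨φ i, hgφ i⟩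
    have hmap : ∀ y : X W, F.map (pull g hg) (F.map y.2 (α y.1)) =
        F.map (push Z (pull g hg) y).2 (α (push Z (pull g hg) y).1) := by
      intro y
      simp only [push, F.map_comp]
      rfl
    have hx : push Z (pull g hg) x = x' := by
      apply wordOf_inj
      · exact h1.1
      · funext q
        rw [wordOf_push, hgw]
    refine ⟨pull g hg, ?_, ?_⟩
    · dsimp only
      rw [hmap, hx]
    · intro y hy
      refine ⟨push Z (pull g hg) y, ?_, hmap y⟩
      dsimp only at hy ⊢
      rw [← hx]
      change key W y < key W x at hy
      change key W' _ < key W' _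
      simp only [key, Prod.Lex.toLex_lt_toLex] at hy ⊢
      rcases hy with hy | ⟨hy, hy'⟩
      · exact Or.inl hy
      · refine Or.inr ⟨hy, ?_⟩
        obtain ⟨i, hi1, hi2⟩ := hy'
        refine ⟨φ i, fun q hq => ?_, ?_⟩
        · have h3 := hi1 (g q) (hlt i q hq)
          change enc (wordOf Z y (g q)) = enc (wordOf Z x (g q)) at h3
          change enc (wordOf Z (push Z (pull g hg) y) q) = enc (wordOf Z (push Z (pull g hg) x) q)
          rw [wordOf_push, wordOf_push, h3]
        · change enc (wordOf Z y i) < enc (wordOf Z x i) at hi2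
          change enc (wordOf Z (push Z (pull g hg) y) (φ i)) <
            enc (wordOf Z (push Z (pull g hg) x) (φ i))
          rw [wordOf_push, wordOf_push, hgφ]
          exact hi2
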